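/- arXiv:1212.4346 — 2 statements merged into one kernel-verified Lean document; each statement's English description precedes it below -/
import Mathlib

section
/- Let G be a connected simple graph on n vertices with Gram matrix K = (L + J)⁻¹. Then for any two vertices i and j, K_{i,j} = (1/(2n)) Σ_{l∈V} (τ(G;i,l) + τ(G;j,l))/τ(G) − (1/(2n²)) Σ_{k,l∈V} τ(G;k,l)/τ(G) + 1/n² − (1/2)·τ(G;i,j)/τ(G). -/
/-- The number of spanning trees of `G`. -/
noncomputable def spanningTreeCount {V : Type*} [Fintype V] (G : SimpleGraph V) : ℕ :=
  Nat.card {H : SimpleGraph V // H ≤ G ∧ H.IsTree}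

/-- `τ(G;i,j)`: the number of spanning forests of `G` with exactly two connected
components such that `i` and `j` lie in different components. -/
noncomputable def twoForestCount {V : Type*} [Fintype V] (G : SimpleGraph V) (i j : V) : ℕ :=
  Nat.card {H : SimpleGraph V //
    H ≤ G ∧ H.IsAcyclic ∧ Nat.card H.ConnectedComponent = 2 ∧ ¬ H.Reachable i j}

namespace SimpleGraph

open scoped Finset

variable {V : Type*}

lemma reachable_or_reachable_of_card_connectedComponent_eq_two {F : SimpleGraph V}
    (hF : Nat.card F.ConnectedComponent = 2) {x y : V} (hxy : ¬F.Reachable x y) (z : V) :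
    F.Reachable x z ∨ F.Reachable y z := by
  obtain ⟨c, -, hc⟩ := (Nat.card_eq_two_iff' (F.connectedComponentMk x)).1 hF
  by_contra! h
  have hy := hc (F.connectedComponentMk y) fun h' ↦ hxy (ConnectedComponent.exact h').symm
  have hz := hc (F.connectedComponentMk z) fun h' ↦ h.1 (ConnectedComponent.exact h').symm
  exact h.2 (ConnectedComponent.exact (hy.trans hz.symm))

lemma card_connectedComponent_eq_two {F : SimpleGraph V} {x y : V} (hxy : ¬F.Reachable x y)
    (h : ∀ z, F.Reachable x z ∨ F.Reachable y z) : Nat.card F.ConnectedComponent = 2 := by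
  refine (Nat.card_eq_two_iff' (F.connectedComponentMk x)).2
    ⟨F.connectedComponentMk y, fun h' ↦ hxy (ConnectedComponent.exact h').symm, ?_⟩
  refine ConnectedComponent.ind fun z hz ↦ ?_
  rcases h z with h | h
  · exact absurd (ConnectedComponent.sound h.symm) hz
  · exact ConnectedComponent.sound h.symm

/-- Deleting the edge `xy` from a connected graph leaves every vertex attached to `x` or `y`. -/
lemma Connected.reachable_deleteEdges_or {T : SimpleGraph V} (hT : T.Connected) (x y z : V) :
    (T.deleteEdges {s(x, y)}).Reachable x z ∨ (T.deleteEdges {s(x, y)}).Reachable y z := by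
  refine Relation.ReflTransGen.head_induction_on ((reachable_iff_reflTransGen z x).1 (hT z x))
    (Or.inl .rfl) fun {a b} hab _ ih ↦ ?_
  by_cases he : s(a, b) = s(x, y)
  · rcases Sym2.eq_iff.1 he with ⟨rfl, -⟩ | ⟨rfl, -⟩
    exacts [Or.inl .rfl, Or.inr .rfl]
  · have : (T.deleteEdges {s(x, y)}).Reachable b a :=
      (Adj.reachable (deleteEdges_adj.2 ⟨hab, he⟩)).symm
    exact ih.imp (·.trans this) (·.trans this)

lemma IsAcyclic.not_reachable_deleteEdges {T : SimpleGraph V} (hT : T.IsAcyclic) {x y : V}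
    (h : T.Adj x y) : ¬(T.deleteEdges {s(x, y)}).Reachable x y :=
  isBridge_iff.1 (isAcyclic_iff_forall_adj_isBridge.1 hT h)

/-- In a tree, each `x ≠ t` has exactly one neighbour on the side of `t`. -/
lemma IsTree.existsUnique_adj_reachable_deleteEdges {T : SimpleGraph V} (hT : T.IsTree) {x t : V}
    (hxt : x ≠ t) : ∃! y, T.Adj x y ∧ (T.deleteEdges {s(x, y)}).Reachable y t := by
  classical
  obtain ⟨p, hp, hpu⟩ := hT.existsUnique_path x t
  cases p with
  | nil => exact absurd rfl hxt
  | @cons _ y _ h p =>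
    rw [Walk.cons_isPath_iff] at hp
    refine ⟨y, ⟨h, reachable_deleteEdges_iff_exists_walk.2
      ⟨p, fun he ↦ hp.2 (p.fst_mem_support_of_mem_edges he)⟩⟩, ?_⟩
    rintro y' ⟨h', hr⟩
    obtain ⟨q, hq⟩ := hr.exists_isPath
    have hx : x ∉ q.support := fun hx ↦
      hT.isAcyclic.not_reachable_deleteEdges h' (q.takeUntil x hx).reachable.symm
    have := hpu (.cons h' (q.mapLe (deleteEdges_le _)))
      ((Walk.cons_isPath_iff _ _).2 ⟨hq.mapLe _, by simpa using hx⟩)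
    simp only [Walk.cons.injEq] at this
    exact this.1

open Classical in
lemma IsTree.sum_adj_reachable_deleteEdges [Fintype V] [DecidableEq V] {T : SimpleGraph V}
    (hT : T.IsTree) (x t : V) :
    (∑ y, if T.Adj x y ∧ (T.deleteEdges {s(x, y)}).Reachable y t then (1 : ℝ) else 0)
      = if x = t then 0 else 1 := by
  split_ifs with hxt
  · subst hxt
    exact Finset.sum_eq_zero fun y _ ↦ if_neg fun h ↦
      hT.isAcyclic.not_reachable_deleteEdges h.1 h.2.symm
  · obtain ⟨y, hy, hu⟩ := hT.existsUnique_adj_reachable_deleteEdges hxt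
    rw [Finset.sum_eq_single y (fun z _ hz ↦ if_neg fun h ↦ hz (hu z h)) (by simp), if_pos hy]

/-- The edge `xy` of `T` is crossed from `x` to `y` on the way from `s` to `t`. -/
def CrossesDart (T : SimpleGraph V) (s t x y : V) : Prop :=
  T.Adj x y ∧ (T.deleteEdges {s(x, y)}).Reachable x s ∧ (T.deleteEdges {s(x, y)}).Reachable y t

open Classical in
lemma IsTree.sum_crossesDart_sub [Fintype V] [DecidableEq V] {T : SimpleGraph V}
    (hT : T.IsTree) (s t x : V) :
    ∑ y, ((if T.CrossesDart s t x y then (1 : ℝ) else 0) - if T.CrossesDart s t y x then 1 else 0)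
      = (if x = s then 1 else 0) - if x = t then 1 else 0 := by
  have key : ∀ y, ((if T.CrossesDart s t x y then (1 : ℝ) else 0) -
        if T.CrossesDart s t y x then 1 else 0)
      = (if T.Adj x y ∧ (T.deleteEdges {s(x, y)}).Reachable y t then (1 : ℝ) else 0)
        - if T.Adj x y ∧ (T.deleteEdges {s(x, y)}).Reachable y s then (1 : ℝ) else 0 := by
    intro y
    by_cases h : T.Adj x y
    · have hs := hT.connected.reachable_deleteEdges_or x y s
      have ht := hT.connected.reachable_deleteEdges_or x y t
      have hn := hT.isAcyclic.not_reachable_deleteEdges h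
      have hs' := fun h₁ h₂ ↦ hn (Reachable.trans (v := s) h₁ (Reachable.symm h₂))
      have ht' := fun h₁ h₂ ↦ hn (Reachable.trans (v := t) h₁ (Reachable.symm h₂))
      simp only [CrossesDart, Sym2.eq_swap (a := y) (b := x), h, h.symm, true_and]
      split_ifs <;> first | tauto | norm_num
    · simp [CrossesDart, h, mt Adj.symm h]
  rw [Finset.sum_congr rfl fun y _ ↦ key y, Finset.sum_sub_distrib,
    hT.sum_adj_reachable_deleteEdges, hT.sum_adj_reachable_deleteEdges]
  split_ifs <;> norm_num

open Classical in
/-- The spanning forests of `G` with two components. -/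
noncomputable def twoForests [Fintype V] (G : SimpleGraph V) : Finset (SimpleGraph V) :=
  {F | F ≤ G ∧ F.IsAcyclic ∧ Nat.card F.ConnectedComponent = 2}

open Classical in
/-- The spanning trees of `G`. -/
noncomputable def spanningTrees [Fintype V] (G : SimpleGraph V) : Finset (SimpleGraph V) :=
  {T | T ≤ G ∧ T.IsTree}

lemma sup_edge_deleteEdges {F : SimpleGraph V} {x y : V} (h : ¬F.Adj x y) :
    (F ⊔ edge x y).deleteEdges {s(x, y)} = F := by
  ext a b
  have := F.adj_comm a b
  simp
  grind

lemma deleteEdges_sup_edge {T : SimpleGraph V} {x y : V} (h : T.Adj x y) :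
    T.deleteEdges {s(x, y)} ⊔ edge x y = T := by
  ext a b
  have := T.adj_comm a b
  have := h.ne
  simp [edge_adj]
  grind

open Classical in
lemma card_twoForests_separating [Fintype V] (G : SimpleGraph V) {x y : V} (h : G.Adj x y)
    (s t : V) :
    #{F ∈ G.twoForests | F.Reachable x s ∧ F.Reachable y t ∧ ¬F.Reachable x y}
      = #{T ∈ G.spanningTrees | T.CrossesDart s t x y} := by
  refine Finset.card_bij' (fun F _ ↦ F ⊔ edge x y) (fun T _ ↦ T.deleteEdges {s(x, y)}) ?_ ?_ ?_ ?_
  · intro F hF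
    simp only [twoForests, Finset.mem_filter, Finset.mem_univ, true_and] at hF
    obtain ⟨⟨hle, hac, hcard⟩, hxs, hyt, hxy⟩ := hF
    have hadj : (F ⊔ edge x y).Adj x y := by simp [edge_adj, h.ne]
    simp only [spanningTrees, Finset.mem_filter, Finset.mem_univ, true_and]
    rw [CrossesDart, sup_edge_deleteEdges fun h ↦ hxy h.reachable]
    refine ⟨⟨sup_le hle (by simpa [edge_le_iff] using Or.inr h), ?_, ?_⟩, hadj, hxs, hyt⟩
    · refine (connected_iff_exists_forall_reachable _).2 ⟨x, fun z ↦ ?_⟩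
      rcases reachable_or_reachable_of_card_connectedComponent_eq_two hcard hxy z with hz | hz
      · exact hz.mono le_sup_left
      · exact hadj.reachable.trans (hz.mono le_sup_left)
    · exact hac.sup_edge_of_not_reachable hxy
  · intro T hT
    simp only [spanningTrees, Finset.mem_filter, Finset.mem_univ, true_and] at hT
    obtain ⟨⟨hle, hT⟩, hadj, hxs, hyt⟩ := hT
    have hn := hT.isAcyclic.not_reachable_deleteEdges hadj
    simp only [twoForests, Finset.mem_filter, Finset.mem_univ, true_and]
    exact ⟨⟨(deleteEdges_le _).trans hle, hT.isAcyclic.anti (deleteEdges_le _),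
      card_connectedComponent_eq_two hn (hT.connected.reachable_deleteEdges_or x y)⟩, hxs, hyt, hn⟩
  · intro F hF
    exact sup_edge_deleteEdges fun h ↦ (Finset.mem_filter.1 hF).2.2.2 h.reachable
  · intro T hT
    exact deleteEdges_sup_edge (Finset.mem_filter.1 hT).2.1

open Classical in
/-- The number of two-component spanning forests with `x` in the component of `s`, and `t` in the
other one: the potential at `x` of a current from `s` to `t`. -/
noncomputable def forestPotential [Fintype V] (G : SimpleGraph V) (s t x : V) : ℝ :=
  #{F ∈ G.twoForests | F.Reachable x s ∧ ¬F.Reachable s t}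

open Classical in
lemma forestPotential_sub [Fintype V] (G : SimpleGraph V) {x y : V} (h : G.Adj x y) (s t : V) :
    G.forestPotential s t x - G.forestPotential s t y
      = ∑ T ∈ G.spanningTrees, ((if T.CrossesDart s t x y then (1 : ℝ) else 0) -
        if T.CrossesDart s t y x then 1 else 0) := by
  rw [Finset.sum_sub_distrib]
  simp only [Finset.sum_boole, forestPotential]
  rw [← card_twoForests_separating G h, ← card_twoForests_separating G h.symm]
  simp only [← Finset.sum_boole]
  rw [← Finset.sum_sub_distrib, ← Finset.sum_sub_distrib]
  refine Finset.sum_congr rfl fun F hF ↦ ?_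
  simp only [twoForests, Finset.mem_filter, Finset.mem_univ, true_and] at hF
  have hst : ¬F.Reachable s t → ∀ z, F.Reachable s z ∨ F.Reachable t z :=
    reachable_or_reachable_of_card_connectedComponent_eq_two hF.2.2
  have e : ∀ {a b}, F.connectedComponentMk a = F.connectedComponentMk b ↔ F.Reachable a b :=
    ConnectedComponent.eq
  simp only [← e] at hst ⊢
  have hx := fun h ↦ hst h x
  have hy := fun h ↦ hst h y
  grind

open Classical in
lemma lapMatrix_mulVec_forestPotential [Fintype V] [DecidableEq V] (G : SimpleGraph V)
    [DecidableRel G.Adj] (s t x : V) :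
    (G.lapMatrix ℝ).mulVec (G.forestPotential s t) x
      = #G.spanningTrees * ((if x = s then 1 else 0) - if x = t then 1 else 0) := by
  have : (G.lapMatrix ℝ).mulVec (G.forestPotential s t) x = ∑ y,
      ∑ T ∈ G.spanningTrees, ((if T.CrossesDart s t x y then (1 : ℝ) else 0) -
        if T.CrossesDart s t y x then 1 else 0) := by
    rw [lapMatrix_mulVec_apply, ← card_neighborFinset_eq_degree, ← nsmul_eq_mul,
      ← Finset.sum_const, ← Finset.sum_sub_distrib]
    refine Finset.sum_subset_zero_on_sdiff (Finset.subset_univ _) (fun y hy ↦ ?_) fun y hy ↦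
      forestPotential_sub G ((mem_neighborFinset _ _ _).1 hy) s t
    refine Finset.sum_eq_zero fun T hT ↦ ?_
    have hT : T ≤ G := (Finset.mem_filter.1 hT).2.1
    have hn : ¬T.Adj x y := fun h ↦ by simp [hT h] at hy
    simp [CrossesDart, hn, mt Adj.symm hn]
  rw [this, Finset.sum_comm, Finset.sum_congr rfl fun T hT ↦
    IsTree.sum_crossesDart_sub (Finset.mem_filter.1 hT).2.2 s t x, Finset.sum_const, nsmul_eq_mul]

lemma spanningTreeCount_eq_card [Fintype V] (G : SimpleGraph V) :
    spanningTreeCount G = #G.spanningTrees := by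
  classical
  simp [spanningTreeCount, spanningTrees, Nat.card_eq_fintype_card, Fintype.card_subtype]

lemma forestPotential_self [Fintype V] (G : SimpleGraph V) (s t : V) :
    G.forestPotential s t s = twoForestCount G s t := by
  classical
  simp [forestPotential, twoForestCount, twoForests, Nat.card_eq_fintype_card,
    Fintype.card_subtype, Finset.filter_filter, and_assoc]

lemma forestPotential_sink [Fintype V] (G : SimpleGraph V) (s t : V) :
    G.forestPotential s t t = 0 := by
  simp [forestPotential, Finset.filter_eq_empty_iff]
  exact fun F _ h ↦ h.symm

lemma Connected.spanningTreeCount_pos [Fintype V] {G : SimpleGraph V} (hG : G.Connected) :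
    0 < spanningTreeCount G := by
  obtain ⟨T, hT⟩ := hG.exists_isTree_le
  have : Nonempty {H : SimpleGraph V // H ≤ G ∧ H.IsTree} := ⟨⟨T, hT⟩⟩
  exact Nat.card_pos

section Gram

open Matrix

lemma ones_mulVec [Fintype V] (w : V → ℝ) :
    (of fun _ _ : V => (1 : ℝ)) *ᵥ w = fun _ ↦ ∑ x, w x := by
  ext; simp [mulVec, dotProduct]

variable [Fintype V] [DecidableEq V] {G : SimpleGraph V} [DecidableRel G.Adj]

lemma sum_lapMatrix_mulVec (w : V → ℝ) : ∑ x, (G.lapMatrix ℝ *ᵥ w) x = 0 := by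
  have : ∑ x, (G.lapMatrix ℝ *ᵥ w) x = (1 : V → ℝ) ⬝ᵥ (G.lapMatrix ℝ *ᵥ w) := by
    simp [dotProduct]
  rw [this, dotProduct_mulVec, ← mulVec_transpose, (G.isSymm_lapMatrix (R := ℝ)).eq]
  have h := G.lapMatrix_mulVec_const_eq_zero (R := ℝ)
  rw [show (1 : V → ℝ) = fun _ ↦ 1 from rfl, h, zero_dotProduct]

lemma Connected.isUnit_lapMatrix_add_ones (hG : G.Connected) :
    IsUnit (G.lapMatrix ℝ + of fun _ _ => (1 : ℝ)) := by
  have := hG.nonempty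
  rw [← mulVec_injective_iff_isUnit, ← coe_mulVecLin, ← LinearMap.ker_eq_bot,
    LinearMap.ker_eq_bot']
  intro w hw
  rw [mulVecLin_apply, add_mulVec, ones_mulVec] at hw
  have hs : ∑ x, w x = 0 := by
    have := congrArg (fun f : V → ℝ ↦ ∑ x, f x) hw
    simpa [Finset.sum_add_distrib, sum_lapMatrix_mulVec] using this
  have hc := (lapMatrix_mulVec_eq_zero_iff_forall_reachable (G := G) (x := w)).1 (by
    ext x; simpa [hs] using congrFun hw x)
  ext x
  rw [Finset.sum_congr rfl fun y _ ↦ hc y x (hG y x)] at hs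
  simpa using hs

lemma isSymm_lapMatrix_add_ones : (G.lapMatrix ℝ + of fun _ _ => (1 : ℝ)).IsSymm :=
  (G.isSymm_lapMatrix (R := ℝ)).add (by ext; simp)

lemma Connected.gram_mulVec_one (hG : G.Connected) :
    (G.lapMatrix ℝ + of fun _ _ => (1 : ℝ))⁻¹ *ᵥ (fun _ ↦ 1)
      = fun _ ↦ (Fintype.card V : ℝ)⁻¹ := by
  have := hG.nonempty
  have hdet := (isUnit_iff_isUnit_det _).1 hG.isUnit_lapMatrix_add_ones
  have : (fun _ ↦ 1 : V → ℝ) = (G.lapMatrix ℝ + of fun _ _ => (1 : ℝ)) *ᵥ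
      ((Fintype.card V : ℝ)⁻¹ • fun _ ↦ 1) := by
    rw [mulVec_smul, add_mulVec, ones_mulVec, lapMatrix_mulVec_const_eq_zero]
    ext; simp
  conv_lhs => arg 2; rw [this]
  rw [mulVec_mulVec, nonsing_inv_mul _ hdet, one_mulVec]
  ext; simp

/-- The effective resistance between `s` and `t` is `τ(G;s,t) / τ(G)`. -/
lemma Connected.twoForestCount_eq (hG : G.Connected) {K : Matrix V V ℝ}
    (hK : K = (G.lapMatrix ℝ + of fun _ _ => (1 : ℝ))⁻¹) (s t : V) :
    (twoForestCount G s t : ℝ) = spanningTreeCount G * (K s s + K t t - 2 * K s t) := by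
  have hdet := (isUnit_iff_isUnit_det _).1 hG.isUnit_lapMatrix_add_ones
  have hsymm : K t s = K s t := by
    have : K.IsSymm := hK ▸ isSymm_lapMatrix_add_ones.inv
    exact this.apply _ _
  set v := G.forestPotential s t with hv
  have hLv : (G.lapMatrix ℝ + of fun _ _ => (1 : ℝ)) *ᵥ v
      = (spanningTreeCount G : ℝ) • (Pi.single s 1 - Pi.single t 1) + (∑ x, v x) • fun _ ↦ 1 := by
    ext x
    rw [add_mulVec, ones_mulVec, Pi.add_apply, lapMatrix_mulVec_forestPotential,
      spanningTreeCount_eq_card]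
    simp [Pi.single_apply]
  have hv' := congrArg (K *ᵥ ·) hLv
  simp only [mulVec_add, mulVec_smul, mulVec_sub, mulVec_single_one] at hv'
  rw [hK, hG.gram_mulVec_one, mulVec_mulVec, nonsing_inv_mul _ hdet, one_mulVec, ← hK] at hv'
  have h₁ := congrFun hv' s
  have h₂ := congrFun hv' t
  rw [hv, forestPotential_self] at h₁
  rw [hv, forestPotential_sink] at h₂
  simp [Matrix.col] at h₁ h₂
  linear_combination h₁ - h₂ - (spanningTreeCount G : ℝ) * hsymm

end Gram

end SimpleGraph

/-- Combinatorial formula for the entries of the Gram matrix `K = (L + J)⁻¹`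
of a connected graph `G` on `n` vertices. -/
theorem stmt_12 {V : Type*} [Fintype V] [DecidableEq V]
    (G : SimpleGraph V) [DecidableRel G.Adj] (hG : G.Connected) (n : ℕ)
    (hn : n = Fintype.card V)
    (K : Matrix V V ℝ)
    (hK : K = (G.lapMatrix ℝ + Matrix.of fun _ _ => (1 : ℝ))⁻¹)
    (i j : V) :
    K i j
      = (1 / (2 * (n : ℝ))) *
          ∑ l : V, ((twoForestCount G i l : ℝ) + (twoForestCount G j l : ℝ))
            / (spanningTreeCount G : ℝ)
        - (1 / (2 * (n : ℝ) ^ 2)) *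
          ∑ k : V, ∑ l : V, (twoForestCount G k l : ℝ) / (spanningTreeCount G : ℝ)
        + 1 / (n : ℝ) ^ 2
        - (1 / 2) * (twoForestCount G i j : ℝ) / (spanningTreeCount G : ℝ) := by
  have hcard : (n : ℝ) ≠ 0 := by
    have := hG.nonempty
    simp [hn]
  have hτ : (spanningTreeCount G : ℝ) ≠ 0 := mod_cast hG.spanningTreeCount_pos.ne'
  have hR : ∀ k l, (twoForestCount G k l : ℝ) / spanningTreeCount G
      = K k k + K l l - 2 * K k l := fun k l ↦ by
    rw [hG.twoForestCount_eq hK, mul_div_cancel_left₀ _ hτ]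
  have hrow : ∀ k, ∑ l, K k l = (n : ℝ)⁻¹ := fun k ↦ by
    have := congrFun hG.gram_mulVec_one k
    rw [← hK, ← hn] at this
    simpa [Matrix.mulVec, dotProduct] using this
  simp only [add_div, Finset.sum_add_distrib, mul_div_assoc, hR, hrow, Finset.sum_sub_distrib,
    ← Finset.mul_sum, Finset.sum_const, Finset.card_univ, nsmul_eq_mul, ← hn]
  field_simp
  ring
end

section
/- Let G be a connected simple graph on n vertices with Gram matrix K = (L + J)⁻¹. Then for every vertex i, K_{i,i} ≥ 1/(d_i + 1) where d_i is the degree of i; in particular K_{i,i} ≥ 1/n, with equality K_{i,i} = 1/n if and only if i is a dominating vertex of G. -/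
open Matrix

lemma Matrix.PosDef.one_div_diag_le_inv_diag {V : Type*} [Fintype V] [DecidableEq V]
    {M : Matrix V V ℝ} (hM : M.PosDef) (i : V) : 1 / M i i ≤ M⁻¹ i i := by
  have hpos : 0 < M i i := hM.diag_pos
  have hdet : IsUnit M.det := (Matrix.isUnit_iff_isUnit_det M).1 hM.isUnit
  have h := hM.posSemidef.dotProduct_mulVec_nonneg
    (M⁻¹ *ᵥ Pi.single i 1 - (1 / M i i) • Pi.single i 1)
  have hsymm : (M⁻¹ *ᵥ Pi.single i 1) ᵥ* M = Pi.single i 1 := by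
    have hT : Mᵀ = M := by simpa using hM.isHermitian.eq
    rw [← Matrix.mulVec_transpose, hT, Matrix.mulVec_mulVec, Matrix.mul_nonsing_inv M hdet,
      Matrix.one_mulVec]
  rw [star_trivial, Matrix.dotProduct_mulVec, Matrix.sub_vecMul, hsymm, Matrix.smul_vecMul] at h
  simp only [sub_dotProduct, dotProduct_sub, smul_dotProduct, dotProduct_smul,
    single_dotProduct, dotProduct_single, Matrix.mulVec_single_one, Matrix.single_one_vecMul,
    Matrix.col_apply, smul_eq_mul, mul_one, one_mul] at h
  have hrow : M.row i ⬝ᵥ M⁻¹.col i = 1 := by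
    have := congrFun (congrFun (Matrix.mul_nonsing_inv M hdet) i) i
    simpa [Matrix.mul_apply, dotProduct] using this
  simp only [hrow, Pi.sub_apply, Pi.smul_apply, Pi.single_eq_same,
    Matrix.row_apply, smul_eq_mul] at h
  field_simp at h ⊢
  nlinarith

namespace SimpleGraph

variable {V : Type*} [Fintype V] [DecidableEq V] (G : SimpleGraph V) [DecidableRel G.Adj]

lemma Connected.posDef_lapMatrix_add_ones (hG : G.Connected) :
    (G.lapMatrix ℝ + Matrix.of fun _ _ => (1 : ℝ)).PosDef := by
  have hL := G.posSemidef_lapMatrix ℝ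
  refine Matrix.PosDef.of_dotProduct_mulVec_pos
    (hL.isHermitian.add (by ext; simp)) fun x hx => ?_
  have hJ : x ⬝ᵥ (Matrix.of fun _ _ => (1 : ℝ)) *ᵥ x = (∑ j, x j) ^ 2 := by
    simp [dotProduct, Matrix.mulVec, Finset.sum_mul, sq]
  have hnn := hL.dotProduct_mulVec_nonneg x
  rw [star_trivial] at hnn ⊢
  rw [Matrix.add_mulVec, dotProduct_add, hJ]
  refine lt_of_le_of_ne (by positivity) fun h => hx ?_
  have hLx : x ⬝ᵥ G.lapMatrix ℝ *ᵥ x = 0 := by nlinarith [sq_nonneg (∑ j, x j)]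
  have hsum : ∑ j, x j = 0 := by
    rw [hLx, zero_add] at h
    exact pow_eq_zero_iff two_ne_zero |>.1 h.symm
  have hconst : ∀ a b, x a = x b := fun a b =>
    (G.lapMatrix_toLinearMap₂'_apply'_eq_zero_iff_forall_reachable x).1
      (by rwa [Matrix.toLinearMap₂'_apply']) a b (hG.preconnected a b)
  have := hG.nonempty
  ext a
  rw [Finset.sum_congr rfl fun j _ => hconst j a] at hsum
  simpa using hsum

lemma lapMatrix_add_ones_apply_self (i : V) :
    (G.lapMatrix ℝ + Matrix.of fun _ _ => (1 : ℝ) : Matrix V V ℝ) i i = G.degree i + 1 := by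
  simp [lapMatrix, degMatrix]

lemma degree_add_one_eq_card_iff (i : V) :
    G.degree i + 1 = Fintype.card V ↔ ∀ j, j ≠ i → G.Adj i j := by
  rw [← G.card_neighborFinset_eq_degree,
    ← Finset.card_insert_of_notMem (G.notMem_neighborFinset_self i),
    Finset.card_eq_iff_eq_univ, Finset.eq_univ_iff_forall]
  simp [or_iff_not_imp_left]

lemma lapMatrix_add_ones_mulVec_single (i : V) (hi : ∀ j, j ≠ i → G.Adj i j) :
    (G.lapMatrix ℝ + Matrix.of fun _ _ => (1 : ℝ) : Matrix V V ℝ) *ᵥ Pi.single i 1 =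
      (Fintype.card V : ℝ) • Pi.single i 1 := by
  ext j
  rw [Matrix.mulVec_single_one, Matrix.col_apply]
  by_cases hj : j = i
  · subst hj
    rw [G.lapMatrix_add_ones_apply_self, ← (G.degree_add_one_eq_card_iff j).2 hi]
    simp
  · simp [lapMatrix, degMatrix, hj, (hi j hj).symm]

end SimpleGraph

/-- For a connected graph `G` on `n` vertices with Gram matrix `K = (L + J)⁻¹`,
`K_{i,i} ≥ 1/(d_i + 1)`; in particular `K_{i,i} ≥ 1/n`, with equality iff `i`
is a dominating vertex of `G`. -/
theorem stmt_13 {V : Type*} [Fintype V] [DecidableEq V]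
    (G : SimpleGraph V) [DecidableRel G.Adj] (hG : G.Connected) (n : ℕ)
    (hn : n = Fintype.card V)
    (K : Matrix V V ℝ)
    (hK : K = (G.lapMatrix ℝ + Matrix.of fun _ _ => (1 : ℝ))⁻¹)
    (i : V) :
    1 / ((G.degree i : ℝ) + 1) ≤ K i i ∧
      1 / (n : ℝ) ≤ K i i ∧
      (K i i = 1 / (n : ℝ) ↔ ∀ j : V, j ≠ i → G.Adj i j) := by
  subst hn
  have hM := hG.posDef_lapMatrix_add_ones
  have hdeg := hM.one_div_diag_le_inv_diag i
  rw [G.lapMatrix_add_ones_apply_self, ← hK] at hdeg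
  have hlt : G.degree i + 1 ≤ Fintype.card V := G.degree_lt_card_verts i
  have hcard : (0 : ℝ) < Fintype.card V := by exact_mod_cast (by omega : 0 < Fintype.card V)
  have hle : 1 / (Fintype.card V : ℝ) ≤ 1 / ((G.degree i : ℝ) + 1) :=
    one_div_le_one_div_of_le (by positivity) (by exact_mod_cast hlt)
  refine ⟨hdeg, hle.trans hdeg, fun h => ?_, fun hi => ?_⟩
  · rw [h, one_div_le_one_div (by positivity) hcard] at hdeg
    exact (G.degree_add_one_eq_card_iff i).1 (le_antisymm hlt (by exact_mod_cast hdeg))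
  · have hdet := (Matrix.isUnit_iff_isUnit_det _).1 hM.isUnit
    have h := congrArg (K *ᵥ ·) (G.lapMatrix_add_ones_mulVec_single i hi)
    simp only [Matrix.mulVec_smul, Matrix.mulVec_mulVec] at h
    rw [hK, Matrix.nonsing_inv_mul _ hdet, ← hK, Matrix.one_mulVec] at h
    have hii := congrFun h i
    simp only [Pi.single_eq_same, Pi.smul_apply, Matrix.mulVec_single_one, Matrix.col_apply,
      smul_eq_mul] at hii
    rw [eq_div_iff hcard.ne', mul_comm, ← hii]
end
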